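/- Let A be any output of Truncated Max-Sum Greedy with threshold τ = (1/3)·OPT on an instance with n ≥ m ≥ 1 in which every item j ∈ J satisfies f({j}) < (1/3)·OPT. Then f_min(A) ≥ (1/3)·OPT. -/

import Mathlib

open Finset

/-- Marginal contribution `Δ_f(j | S) = f(S ∪ {j}) − f(S)`. -/
def marg {ι : Type*} [DecidableEq ι] (f : Finset ι → ℝ) (j : ι) (S : Finset ι) : ℝ :=
  f (insert j S) - f S

/-- The set of items allocated by a (partial) allocation `A`. -/
def allocSet {ι : Type*} [DecidableEq ι] {m : ℕ} (A : Fin m → Finset ι) : Finset ι :=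
  Finset.univ.sup A

/-- One step of Truncated Max-Sum Greedy with threshold `τ`: allocate an unallocated item `j`
to a player `p` with `f(A p) < τ` so that the marginal contribution `Δ_f(j | A p)` is maximal
among all such pairs. -/
def GreedyStep {ι : Type*} [DecidableEq ι] {m : ℕ} (f : Finset ι → ℝ) (τ : ℝ)
    (J : Finset ι) (A A' : Fin m → Finset ι) : Prop :=
  ∃ j p, j ∈ J ∧ j ∉ allocSet A ∧ f (A p) < τ ∧
    (∀ j' ∈ J, j' ∉ allocSet A → ∀ p' : Fin m, f (A p') < τ →
      marg f j' (A p') ≤ marg f j (A p)) ∧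
    A' = Function.update A p (insert j (A p))

/-- A possible output of Truncated Max-Sum Greedy with threshold `τ` on items `J` with `m`
players: start by giving each of the `m` players one of the `m` items of largest singleton
value, then repeatedly perform greedy steps, stopping exactly when either all items are
allocated or all players have value at least `τ`. -/
def GreedyOutput {ι : Type*} [DecidableEq ι] (f : Finset ι → ℝ) (τ : ℝ) (J : Finset ι)
    (m : ℕ) (A : Fin m → Finset ι) : Prop :=
  ∃ g : Fin m ↪ ι, (∀ p, g p ∈ J) ∧
    (∀ j ∈ J, (∀ p, g p ≠ j) → ∀ p, f {j} ≤ f {g p}) ∧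
    Relation.ReflTransGen (GreedyStep f τ J) (fun p => {g p}) A ∧
    (allocSet A = J ∨ ∀ p, τ ≤ f (A p))

/-- `A` is an allocation: pairwise disjoint subsets of `J` covering `J`. -/
def IsAllocation {ι : Type*} (J : Finset ι) {m : ℕ} (A : Fin m → Finset ι) : Prop :=
  (∀ p, A p ⊆ J) ∧ (∀ p q : Fin m, p ≠ q → Disjoint (A p) (A q)) ∧ (∀ j ∈ J, ∃ p, j ∈ A p)

theorem marg_anti {ι : Type*} [DecidableEq ι] (J : Finset ι) (f : Finset ι → ℝ)
    (hmono : ∀ S T : Finset ι, S ⊆ T → T ⊆ J → f S ≤ f T)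
    (hsub : ∀ S T : Finset ι, S ⊆ J → T ⊆ J → f (S ∪ T) + f (S ∩ T) ≤ f S + f T)
    (S T : Finset ι) (hST : S ⊆ T) (hT : T ⊆ J) (j : ι) (hj : j ∈ J) :
    marg f j T ≤ marg f j S := by
  unfold marg
  have hS : insert j S ⊆ J := Finset.insert_subset hj (hST.trans hT)
  by_cases h : j ∈ T
  · rw [Finset.insert_eq_of_mem h]
    have := hmono S (insert j S) (Finset.subset_insert _ _) hS
    linarith
  · have h1 := hsub (insert j S) T hS hT
    have e1 : insert j S ∪ T = insert j T := by
      rw [Finset.insert_union, Finset.union_eq_right.2 hST]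
    have e2 : insert j S ∩ T = S := by
      rw [Finset.insert_inter_of_notMem h, Finset.inter_eq_left.2 hST]
    rw [e1, e2] at h1
    linarith

theorem union_le_sum_marg {ι : Type*} [DecidableEq ι] (J : Finset ι) (f : Finset ι → ℝ)
    (hmono : ∀ S T : Finset ι, S ⊆ T → T ⊆ J → f S ≤ f T)
    (hsub : ∀ S T : Finset ι, S ⊆ J → T ⊆ J → f (S ∪ T) + f (S ∩ T) ≤ f S + f T)
    (S T : Finset ι) (hS : S ⊆ J) (hT : T ⊆ J) :
    f (S ∪ T) - f S ≤ ∑ j ∈ T, marg f j S := by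
  induction T using Finset.induction_on with
  | empty => simp
  | insert a T ha ih =>
    rw [Finset.insert_subset_iff] at hT
    have h1 := ih hT.2
    have h2 := marg_anti J f hmono hsub S (S ∪ T) Finset.subset_union_left
      (Finset.union_subset hS hT.2) a hT.1
    rw [Finset.sum_insert ha, Finset.union_insert]
    unfold marg at h2 h1 ⊢
    linarith

theorem mem_allocSet' {ι : Type*} [DecidableEq ι] {m : ℕ} (A : Fin m → Finset ι) (j : ι) :
    j ∈ allocSet A ↔ ∃ p, j ∈ A p := by
  simp [allocSet, Finset.mem_sup]

theorem greedy_inv {ι : Type*} [DecidableEq ι] {m : ℕ} (J : Finset ι) (f : Finset ι → ℝ)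
    (hf0 : f ∅ = 0)
    (hmono : ∀ S T : Finset ι, S ⊆ T → T ⊆ J → f S ≤ f T)
    (hsub : ∀ S T : Finset ι, S ⊆ J → T ⊆ J → f (S ∪ T) + f (S ∩ T) ≤ f S + f T)
    (τ : ℝ) (hsmall : ∀ j ∈ J, f {j} < τ)
    (g : Fin m ↪ ι) (hg : ∀ p, g p ∈ J) (A : Fin m → Finset ι)
    (h : Relation.ReflTransGen (GreedyStep f τ J) (fun p => {g p}) A) :
    (∀ p, A p ⊆ J) ∧ (∀ p, f (A p) < 2 * τ) ∧
      ∀ q, f (A q) < τ → ∑ j ∈ allocSet A, marg f j (A q) ≤ ∑ p, f (A p) := by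
  have hsing : ∀ j ∈ J, ∀ S, S ⊆ J → marg f j S ≤ f {j} := by
    intro j hj S hS
    have := marg_anti J f hmono hsub ∅ S (Finset.empty_subset _) hS j hj
    simpa [marg, hf0] using this
  induction h with
  | refl =>
    refine ⟨fun p => by simpa using hg p, fun p => ?_, fun q _ => ?_⟩
    · have h1 := hsmall _ (hg p)
      have h2 := hmono ∅ {g p} (Finset.empty_subset _) (by simpa using hg p)
      simp only
      linarith
    · have e : allocSet (fun p => ({g p} : Finset ι)) = Finset.univ.map g := by
        ext j
        simp [mem_allocSet', eq_comm]
      rw [e, Finset.sum_map]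
      exact Finset.sum_le_sum fun p _ => hsing _ (hg p) _ (by simpa using hg q)
  | @tail C C' _ hstep ih =>
    obtain ⟨ih1, ih2, ih3⟩ := ih
    obtain ⟨j, p, hj, hjn, hp, hmax, rfl⟩ := hstep
    have hsubJ : ∀ r, Function.update C p (insert j (C p)) r ⊆ J := by
      intro r
      by_cases hr : r = p
      · subst hr
        simpa using Finset.insert_subset hj (ih1 r)
      · simpa [hr] using ih1 r
    have hge : ∀ r, C r ⊆ Function.update C p (insert j (C p)) r := by
      intro r
      by_cases hr : r = p
      · subst hr
        simp
      · simp [hr]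
    refine ⟨hsubJ, fun r => ?_, fun q hq => ?_⟩
    · by_cases hr : r = p
      · subst hr
        have h1 := hsing j hj _ (ih1 r)
        have h2 := hsmall j hj
        simp only [Function.update_self]
        unfold marg at h1
        linarith
      · simpa [hr] using ih2 r
    · have hq' : f (C q) < τ := lt_of_le_of_lt (hmono _ _ (hge q) (hsubJ q)) hq
      have e : allocSet (Function.update C p (insert j (C p))) = insert j (allocSet C) := by
        ext i
        rw [Finset.mem_insert, mem_allocSet', mem_allocSet']
        constructor
        · rintro ⟨r, hr⟩
          by_cases hrp : r = p
          · subst hrp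
            simp only [Function.update_self, Finset.mem_insert] at hr
            exact hr.imp id fun h => ⟨r, h⟩
          · rw [Function.update_of_ne hrp] at hr
            exact Or.inr ⟨r, hr⟩
        · rintro (rfl | ⟨r, hr⟩)
          · exact ⟨p, by simp⟩
          · exact ⟨r, hge r hr⟩
      have hs : ∑ r, f (Function.update C p (insert j (C p)) r)
          = ∑ r, f (C r) + marg f j (C p) := by
        rw [← Finset.add_sum_erase _ _ (Finset.mem_univ p),
          ← Finset.add_sum_erase _ (fun r => f (C r)) (Finset.mem_univ p)]
        have : ∑ r ∈ Finset.univ.erase p, f (Function.update C p (insert j (C p)) r)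
            = ∑ r ∈ Finset.univ.erase p, f (C r) :=
          Finset.sum_congr rfl fun r hr => by
            rw [Function.update_of_ne (Finset.ne_of_mem_erase hr)]
        rw [this, Function.update_self]
        unfold marg
        ring
      rw [e, Finset.sum_insert hjn, hs]
      have hanti := fun i hi => marg_anti J f hmono hsub _ _ (hge q) (hsubJ q) i hi
      have h1 := hanti j hj
      have h2 := hmax j hj hjn q hq'
      have h3 := ih3 q hq'
      have h4 : ∑ i ∈ allocSet C, marg f i (Function.update C p (insert j (C p)) q)
          ≤ ∑ i ∈ allocSet C, marg f i (C q) :=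
        Finset.sum_le_sum fun i hi => hanti i (by
          obtain ⟨r, hr⟩ := (mem_allocSet' _ _).1 hi
          exact ih1 r hr)
      linarith

/-- any output of Truncated Max-Sum Greedy with threshold `(1/3)·OPT`, on an
instance with `n ≥ m ≥ 1` in which every item has singleton value `< (1/3)·OPT`, satisfies
`f_min(A) ≥ (1/3)·OPT`. -/
theorem stmt5 {ι : Type*} [DecidableEq ι] {m : ℕ} (hm : 1 ≤ m)
    (J : Finset ι) (hn : m ≤ J.card)
    (f : Finset ι → ℝ) (hf0 : f ∅ = 0)
    (hmono : ∀ S T : Finset ι, S ⊆ T → T ⊆ J → f S ≤ f T)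
    (hsub : ∀ S T : Finset ι, S ⊆ J → T ⊆ J → f (S ∪ T) + f (S ∩ T) ≤ f S + f T)
    (OPT : ℝ)
    (hOPT : IsGreatest {t : ℝ | ∃ A : Fin m → Finset ι, IsAllocation J A ∧
      IsLeast (Set.range fun p => f (A p)) t} OPT)
    (hsmall : ∀ j ∈ J, f {j} < (1 / 3) * OPT)
    (A : Fin m → Finset ι) (hA : GreedyOutput f ((1 / 3) * OPT) J m A) :
    ∀ p, (1 / 3) * OPT ≤ f (A p) := by
  obtain ⟨g, hg, -, hrun, hend⟩ := hA
  obtain ⟨h1, h2, h3⟩ := greedy_inv J f hf0 hmono hsub _ hsmall g hg A hrun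
  rcases hend with hend | hend
  swap
  · exact hend
  intro q
  by_contra hq
  rw [not_le] at hq
  have h4 := h3 q hq
  rw [hend] at h4
  obtain ⟨⟨O, ⟨hO1, hO2, hO3⟩, hO⟩, -⟩ := hOPT
  have eJ : J = Finset.univ.biUnion O := by
    ext j
    simp only [Finset.mem_biUnion, Finset.mem_univ, true_and]
    exact ⟨hO3 j, fun ⟨p, hp⟩ => hO1 p hp⟩
  have h5 : ∑ j ∈ J, marg f j (A q) = ∑ p, ∑ j ∈ O p, marg f j (A q) := by
    conv_lhs => rw [eJ]
    exact Finset.sum_biUnion fun p _ r _ hpr => hO2 p r hpr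
  rw [h5] at h4
  have h6 : ∑ p, f (A p) < ∑ p, ∑ j ∈ O p, marg f j (A q) := by
    refine Finset.sum_lt_sum_of_nonempty ⟨q, Finset.mem_univ q⟩ fun p _ => ?_
    have a1 := union_le_sum_marg J f hmono hsub (A q) (O p) (h1 q) (hO1 p)
    have a2 := hmono (O p) (A q ∪ O p) Finset.subset_union_right
      (Finset.union_subset (h1 q) (hO1 p))
    have a3 : OPT ≤ f (O p) := hO.2 ⟨p, rfl⟩
    have a4 := h2 p
    linarith
  linarith
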